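/- arXiv:1607.00154 — 4 statements merged into one kernel-verified Lean document; each statement's English description precedes it below -/
import Mathlib

section
/- Let n ≥ 2 be an integer and p > 1. For every u ∈ C_c^∞(B_n), one has ‖u‖_p ≤ (p/(n-1)) ‖∇_g u‖_p, i.e. ∫_{B_n} |u(x)|^p (2/(1-|x|²))^n dx ≤ (p/(n-1))^p ∫_{B_n} ((1-|x|²)/2)^p |∇u(x)|^p (2/(1-|x|²))^n dx. (This is the case m = 1 of the main Poincaré inequality, with sharp constant C(n,1,p) = p/(n-1).) -/
open MeasureTheory

lemma rpow_sub_one_mul_le {a h k p : ℝ} (ha : 0 ≤ a) (hh : 0 ≤ h) (hk : 0 < k) (hp : 1 < p) :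
    p * (a ^ (p - 1) * h) ≤ k * ((p - 1) * a ^ p + k⁻¹ ^ p * h ^ p) := by
  have hp0 : 0 < p := by linarith
  have hp1 : 0 < p - 1 := by linarith
  have hpq : (p / (p - 1)).HolderConjugate p := (Real.HolderConjugate.conjExponent hp).symm
  have hY := Real.young_inequality_of_nonneg (Real.rpow_nonneg ha (p - 1))
    (mul_nonneg (inv_nonneg.2 hk.le) hh) hpq
  rw [← Real.rpow_mul ha, mul_div_cancel₀ _ hp1.ne',
    Real.mul_rpow (inv_nonneg.2 hk.le) hh] at hY
  have h1 : p * (a ^ (p - 1) * h) = k * (p * (a ^ (p - 1) * (k⁻¹ * h))) := by field_simp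
  have h2 : (p - 1) * a ^ p + k⁻¹ ^ p * h ^ p
      = p * (a ^ p / (p / (p - 1)) + k⁻¹ ^ p * h ^ p / p) := by field_simp
  rw [h1, h2]
  gcongr

section Divergence

variable {E : Type*} [NormedAddCommGroup E] [InnerProductSpace ℝ E]

/-- The divergence of a vector field, as the trace of its derivative. -/
noncomputable def divergence (F : E → E) (x : E) : ℝ :=
  LinearMap.trace ℝ E (fderiv ℝ F x).toLinearMap

lemma divergence_smul [FiniteDimensional ℝ E] {g : E → ℝ} {g' : E →L[ℝ] ℝ} {X : E → E} {x : E}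
    (hg : HasFDerivAt g g' x) (hX : DifferentiableAt ℝ X x) :
    divergence (fun y => g y • X y) x = g x * divergence X x + g' (X x) := by
  have h : ((g'.smulRight (X x)).toLinearMap : E →ₗ[ℝ] E) = g'.toLinearMap.smulRight (X x) := rfl
  have hd : fderiv ℝ (fun y => g y • X y) x = g x • fderiv ℝ X x + g'.smulRight (X x) :=
    (hg.smul hX.hasFDerivAt).fderiv
  rw [divergence, divergence, hd, ContinuousLinearMap.toLinearMap_add,
    ContinuousLinearMap.toLinearMap_smul, map_add, map_smul, h, LinearMap.trace_smulRight]
  rfl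

lemma divergence_add {X Y : E → E} {x : E} (hX : DifferentiableAt ℝ X x)
    (hY : DifferentiableAt ℝ Y x) :
    divergence (fun y => X y + Y y) x = divergence X x + divergence Y x := by
  simp [divergence, fderiv_fun_add hX hY]

lemma divergence_sub_const [FiniteDimensional ℝ E] (ξ x : E) :
    divergence (fun y => y - ξ) x = Module.finrank ℝ E := by
  simp [divergence, fderiv_sub_const]

lemma continuous_divergence [FiniteDimensional ℝ E] {F : E → E} (hF : ContDiff ℝ 1 F) :
    Continuous (divergence F) := by
  have h : Continuous fun A : E →L[ℝ] E => LinearMap.trace ℝ E A.toLinearMap :=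
    (LinearMap.trace ℝ E ∘ₗ ContinuousLinearMap.coeLM ℝ).continuous_of_finiteDimensional
  exact h.comp (hF.continuous_fderiv one_ne_zero)

lemma divergence_eq_zero_of_notMem_tsupport {F : E → E} {x : E} (hx : x ∉ tsupport F) :
    divergence F x = 0 := by
  have : fderiv ℝ F x = 0 := by
    by_contra h
    exact hx (support_fderiv_subset ℝ h)
  simp [divergence, this]

lemma integral_divergence_eq_zero [FiniteDimensional ℝ E] [MeasurableSpace E] [BorelSpace E]
    {F : E → E} (hF : ContDiff ℝ 1 F) (hc : HasCompactSupport F) :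
    ∫ x, divergence F x = 0 := by
  let b := stdOrthonormalBasis ℝ E
  have hd : ∀ i, Integrable fun x => inner ℝ (b i) (fderiv ℝ F x (b i)) := fun i =>
    Continuous.integrable_of_hasCompactSupport
      (continuous_const.inner ((hF.continuous_fderiv one_ne_zero).clm_apply continuous_const))
      ((hc.fderiv ℝ).mono fun x hx h0 => hx (by simp [h0]))
  have hz : ∀ i, ∫ x, inner ℝ (b i) (fderiv ℝ F x (b i)) = 0 := fun i => by
    have hd' : ∀ x, fderiv ℝ (fun y => inner ℝ (b i) (F y)) x (b i)
        = inner ℝ (b i) (fderiv ℝ F x (b i)) := fun x => by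
      rw [fderiv_inner_apply ℝ (differentiableAt_const _) (hF.differentiable one_ne_zero x)]
      simp
    have := integral_mul_fderiv_eq_neg_fderiv_mul_of_integrable (μ := volume) (f := fun _ : E => (1 : ℝ))
      (g := fun y => inner ℝ (b i) (F y)) (v := b i) (by simp) (by simpa [hd'] using hd i)
      (by simpa using Continuous.integrable_of_hasCompactSupport
            (continuous_const.inner hF.continuous)
            (hc.mono fun x hx h0 => hx (by simp [h0])))
      (by simp) (fun x _ => (differentiableAt_const _).inner ℝ (hF.differentiable one_ne_zero x))
    simpa [hd'] using this
  simp_rw [divergence, LinearMap.trace_eq_sum_inner _ b]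
  refine (integral_finsetSum _ fun i _ => hd i).trans ?_
  exact Finset.sum_eq_zero fun i _ => hz i

end Divergence

section Horospherical

variable {E : Type*} [NormedAddCommGroup E]

/-- The conformal factor of the Poincaré ball metric. -/
noncomputable def conformalFactor (x : E) : ℝ := 2 / (1 - ‖x‖ ^ 2)

lemma one_sub_norm_sq_pos {x : E} (hx : ‖x‖ < 1) : 0 < 1 - ‖x‖ ^ 2 := by
  nlinarith [norm_nonneg x]

lemma conformalFactor_pos {x : E} (hx : ‖x‖ < 1) : 0 < conformalFactor x :=
  div_pos two_pos (one_sub_norm_sq_pos hx)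

lemma norm_sq_mul_conformalFactor {x : E} (hx : ‖x‖ < 1) :
    ‖x‖ ^ 2 * conformalFactor x = conformalFactor x - 2 := by
  have := one_sub_norm_sq_pos hx
  unfold conformalFactor
  field_simp
  ring

lemma norm_sub_sq_pos {ξ x : E} (hξ : ‖ξ‖ = 1) (hx : ‖x‖ < 1) : 0 < ‖x - ξ‖ ^ 2 := by
  have : x - ξ ≠ 0 := fun h => by rw [sub_eq_zero.1 h, hξ] at hx; exact hx.false
  exact pow_pos (norm_pos_iff.2 this) 2

variable [InnerProductSpace ℝ E]

lemma contDiffAt_conformalFactor {x : E} (hx : ‖x‖ < 1) : ContDiffAt ℝ 1 conformalFactor x :=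
  contDiffAt_const.div (contDiffAt_const.sub (contDiff_norm_sq ℝ).contDiffAt)
    (one_sub_norm_sq_pos hx).ne'

lemma hasFDerivAt_conformalFactor_pow (m : ℕ) {x : E} (hx : ‖x‖ < 1) :
    HasFDerivAt (fun y : E => conformalFactor y ^ m)
      ((m * conformalFactor x ^ (m + 1)) • innerSL ℝ x) x := by
  have hs := one_sub_norm_sq_pos hx
  have h1 := ((hasFDerivAt_id x).norm_sq.const_sub 1)
  have h2 := (hasDerivAt_inv (𝕜 := ℝ) hs.ne').comp_hasFDerivAt x h1
  have h3 := (h2.const_mul 2).pow m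
  refine (h3.congr_fderiv ?_).congr_of_eventuallyEq (.of_forall fun y => ?_)
  · ext v
    rcases m with _ | m
    · simp
    · simp [conformalFactor, pow_succ, div_eq_mul_inv]
      ring
  · simp [conformalFactor, div_eq_mul_inv]

/-- In dimension `m + 2`, the Riemannian gradient of a Busemann function centred at `ξ`,
rescaled so that its Euclidean divergence is the Riemannian divergence density. -/
noncomputable def horosphericalField (m : ℕ) (ξ x : E) : E :=
  conformalFactor x ^ (m + 1) • x
    + (2 * conformalFactor x ^ m * (‖x - ξ‖ ^ 2)⁻¹) • (x - ξ)

lemma two_mul_inner_sub {ξ : E} (hξ : ‖ξ‖ = 1) (x : E) :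
    2 * inner ℝ x (x - ξ) = ‖x - ξ‖ ^ 2 - 2 / conformalFactor x := by
  rw [norm_sub_sq_real, hξ, inner_sub_right, real_inner_self_eq_norm_sq, conformalFactor,
    div_div_cancel₀ two_ne_zero]
  ring

lemma norm_horosphericalField (m : ℕ) {ξ x : E} (hξ : ‖ξ‖ = 1) (hx : ‖x‖ < 1) :
    ‖horosphericalField m ξ x‖ = conformalFactor x ^ (m + 1) := by
  have hρ := conformalFactor_pos hx
  have hD := norm_sub_sq_pos hξ hx
  rw [← sq_eq_sq₀ (norm_nonneg _) (by positivity), horosphericalField, norm_add_sq_real,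
    inner_smul_left, inner_smul_right, norm_smul, norm_smul, mul_pow, mul_pow]
  have h1 := norm_sq_mul_conformalFactor hx
  have h2 : inner ℝ x (x - ξ) = (‖x - ξ‖ ^ 2 - 2 / conformalFactor x) / 2 := by
    linarith [two_mul_inner_sub hξ x]
  have h3 : ‖x‖ ^ 2 = (conformalFactor x - 2) / conformalFactor x := by
    rw [← h1]; field_simp
  rw [h2, h3]
  generalize conformalFactor x = ρ at *
  generalize ‖x - ξ‖ ^ 2 = D at *
  simp only [Real.norm_eq_abs, sq_abs, conj_trivial]
  field_simp
  ring

lemma contDiffAt_horosphericalField (m : ℕ) {ξ x : E} (hξ : ‖ξ‖ = 1) (hx : ‖x‖ < 1) :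
    ContDiffAt ℝ 1 (horosphericalField m ξ) x := by
  have h := contDiffAt_conformalFactor hx
  have hs : ContDiffAt ℝ 1 (fun y : E => y - ξ) x := contDiffAt_id.sub contDiffAt_const
  exact ((h.pow _).smul contDiffAt_id).add
    (((contDiffAt_const.mul (h.pow _)).mul
      ((hs.norm_sq ℝ).inv (norm_sub_sq_pos hξ hx).ne')).smul hs)

lemma divergence_horosphericalField [FiniteDimensional ℝ E] (m : ℕ)
    (hm : Module.finrank ℝ E = m + 2) {ξ x : E} (hξ : ‖ξ‖ = 1) (hx : ‖x‖ < 1) :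
    divergence (horosphericalField m ξ) x = (m + 1) * conformalFactor x ^ (m + 2) := by
  have hρ := conformalFactor_pos hx
  have hD := norm_sub_sq_pos hξ hx
  have ha := hasFDerivAt_conformalFactor_pow (m + 1) hx
  have hb := ((hasFDerivAt_conformalFactor_pow m hx).const_mul 2).mul
    ((hasDerivAt_inv (𝕜 := ℝ) hD.ne').comp_hasFDerivAt x ((hasFDerivAt_id x).sub_const ξ).norm_sq)
  have hid : DifferentiableAt ℝ (fun y : E => y) x := differentiableAt_id
  have hsub : DifferentiableAt ℝ (fun y : E => y - ξ) x := hid.sub_const ξ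
  have hdid : divergence (fun y : E => y) x = m + 2 := by
    simpa [hm] using divergence_sub_const (0 : E) x
  have hdsub : divergence (fun y : E => y - ξ) x = m + 2 := by
    simp [divergence_sub_const, hm]
  have h1 := norm_sq_mul_conformalFactor hx
  have h2 : inner ℝ x (x - ξ) = (‖x - ξ‖ ^ 2 - 2 / conformalFactor x) / 2 := by
    linarith [two_mul_inner_sub hξ x]
  have h3 : ‖x‖ ^ 2 = (conformalFactor x - 2) / conformalFactor x := by
    rw [← h1]; field_simp
  have key := divergence_add (ha.differentiableAt.smul hid) (hb.differentiableAt.smul hsub)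
  refine key.trans ?_
  erw [divergence_smul ha hid, divergence_smul hb hsub]
  rw [hdid, hdsub]
  simp [-map_sub, h2, h3]
  generalize conformalFactor x = ρ at *
  generalize ‖x - ξ‖ ^ 2 = D at *
  field_simp
  ring

lemma le_add_divergence_smul_horosphericalField [FiniteDimensional ℝ E] {m : ℕ}
    (hm : Module.finrank ℝ E = m + 2) {p : ℝ} (hp : 1 < p) {u : E → ℝ} (hu : Differentiable ℝ u)
    {ξ x : E} (hξ : ‖ξ‖ = 1) (hx : ‖x‖ < 1) :
    |u x| ^ p * conformalFactor x ^ (m + 2) ≤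
      (p / (m + 1)) ^ p * ((conformalFactor x)⁻¹ ^ p * ‖fderiv ℝ u x‖ ^ p *
          conformalFactor x ^ (m + 2))
        + p / (m + 1) * divergence (fun y => |u y| ^ p • horosphericalField m ξ y) x := by
  have hp0 : 0 < p := by linarith
  have hρ := conformalFactor_pos hx
  have hφ : DifferentiableAt ℝ (fun y => |u y| ^ p) x := hu.norm_rpow hp x
  rw [divergence_smul hφ.hasFDerivAt
      ((contDiffAt_horosphericalField m hξ hx).differentiableAt one_ne_zero),
    divergence_horosphericalField m hm hξ hx]
  have hlow : -(p * |u x| ^ (p - 1) * ‖fderiv ℝ u x‖ * conformalFactor x ^ (m + 1)) ≤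
      fderiv ℝ (fun y => |u y| ^ p) x (horosphericalField m ξ x) := by
    refine neg_le_of_neg_le (le_trans (neg_le_abs _) ?_)
    refine ((fderiv ℝ (fun y => |u y| ^ p) x).le_opNorm (horosphericalField m ξ x)).trans ?_
    rw [norm_horosphericalField m hξ hx]
    gcongr
    exact norm_fderiv_norm_rpow_le hu hp
  have hk : (0 : ℝ) < (m + 1) / p := by positivity
  have hY := rpow_sub_one_mul_le (abs_nonneg (u x))
    (mul_nonneg (inv_nonneg.2 hρ.le) (norm_nonneg (fderiv ℝ u x))) hk hp
  rw [Real.mul_rpow (inv_nonneg.2 hρ.le) (norm_nonneg _), inv_div] at hY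
  have hY' := mul_le_mul_of_nonneg_right hY (pow_nonneg hρ.le (m + 2))
  have h1 : p * (|u x| ^ (p - 1) * ((conformalFactor x)⁻¹ * ‖fderiv ℝ u x‖))
      * conformalFactor x ^ (m + 2)
      = p * |u x| ^ (p - 1) * ‖fderiv ℝ u x‖ * conformalFactor x ^ (m + 1) := by
    field_simp
    ring
  rw [h1] at hY'
  have hfin := mul_le_mul_of_nonneg_left (hlow.trans' (neg_le_neg hY'))
    (show (0 : ℝ) ≤ p / (m + 1) by positivity)
  have h2 : ∀ z w : ℝ, p / (m + 1) * -((m + 1) / p * ((p - 1) * z + w) *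
      conformalFactor x ^ (m + 2)) = -(((p - 1) * z + w) * conformalFactor x ^ (m + 2)) := by
    intro z w; field_simp
  rw [h2] at hfin
  have h3 : p / (m + 1) * (|u x| ^ p * ((m + 1) * conformalFactor x ^ (m + 2)))
      = p * (|u x| ^ p * conformalFactor x ^ (m + 2)) := by field_simp
  rw [mul_add, h3]
  linarith

end Horospherical

lemma integrableOn_of_continuousOn_of_support_subset {X : Type*} [TopologicalSpace X] [T2Space X]
    [MeasurableSpace X] [OpensMeasurableSpace X] {μ : Measure X} [IsFiniteMeasureOnCompacts μ]
    {f : X → ℝ} {s K : Set X} (hf : ContinuousOn f s) (hK : IsCompact K) (hKs : K ⊆ s)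
    (h0 : Function.support f ⊆ K) : IntegrableOn f s μ :=
  ((integrableOn_iff_integrable_of_support_subset h0).1
    ((hf.mono hKs).integrableOn_compact hK)).integrableOn


/-- first-order Poincaré inequality on the ball model of hyperbolic space,
in the integral form
∫ |u|^p dV_g ≤ (p/(n-1))^p ∫ ((1-|x|²)/2)^p |∇u|^p dV_g. -/
theorem poincare_order_one (n : ℕ) (hn : 2 ≤ n) (p : ℝ) (hp : 1 < p)
    (u : EuclideanSpace ℝ (Fin n) → ℝ)
    (hu : ContDiff ℝ (⊤ : ℕ∞) u) (hcs : HasCompactSupport u)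
    (hsupp : tsupport u ⊆ Metric.ball (0 : EuclideanSpace ℝ (Fin n)) 1) :
    ∫ x in Metric.ball (0 : EuclideanSpace ℝ (Fin n)) 1,
        |u x| ^ p * (2 / (1 - ‖x‖ ^ 2)) ^ n
      ≤ (p / ((n : ℝ) - 1)) ^ p *
        ∫ x in Metric.ball (0 : EuclideanSpace ℝ (Fin n)) 1,
          ((1 - ‖x‖ ^ 2) / 2) ^ p * ‖gradient u x‖ ^ p * (2 / (1 - ‖x‖ ^ 2)) ^ n := by
  obtain ⟨m, rfl⟩ := Nat.exists_eq_add_of_le' hn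
  have hp0 : 0 < p := by linarith
  set B := Metric.ball (0 : EuclideanSpace ℝ (Fin (m + 2))) 1
  have hB : ∀ {x}, x ∈ B ↔ ‖x‖ < 1 := mem_ball_zero_iff
  have hm : Module.finrank ℝ (EuclideanSpace ℝ (Fin (m + 2))) = m + 2 := by simp
  let ξ : EuclideanSpace ℝ (Fin (m + 2)) := EuclideanSpace.single 0 1
  have hξ : ‖ξ‖ = 1 := by simp [ξ]
  have hu1 : ContDiff ℝ 1 u := hu.of_le (by exact_mod_cast le_top)
  let F := fun y => |u y| ^ p • horosphericalField m ξ y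
  have hFsupp : tsupport F ⊆ tsupport u :=
    closure_mono fun x hx h0 => hx (by simp [F, h0, Real.zero_rpow hp0.ne'])
  have hFc : HasCompactSupport F := hcs.of_isClosed_subset (isClosed_tsupport F) hFsupp
  have hF : ContDiff ℝ 1 F := by
    refine contDiff_iff_contDiffAt.2 fun x => ?_
    by_cases hx : x ∈ tsupport F
    · exact (hu1.norm_rpow hp).contDiffAt.smul
        (contDiffAt_horosphericalField m hξ (hB.1 (hsupp (hFsupp hx))))
    · exact contDiffAt_const.congr_of_eventuallyEq (notMem_tsupport_iff_eventuallyEq.1 hx)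
  have hdiv : ∫ x in B, divergence F x = 0 := by
    rw [setIntegral_eq_integral_of_forall_compl_eq_zero fun x hx =>
      divergence_eq_zero_of_notMem_tsupport fun h => hx (hsupp (hFsupp h))]
    exact integral_divergence_eq_zero hF hFc
  have hdivi : IntegrableOn (divergence F) B :=
    integrableOn_of_continuousOn_of_support_subset (continuous_divergence hF).continuousOn hcs
      hsupp fun x hx => hFsupp (by_contra fun h => hx (divergence_eq_zero_of_notMem_tsupport h))
  have hρc : ContinuousOn conformalFactor B := fun x hx =>
    (contDiffAt_conformalFactor (hB.1 hx)).continuousAt.continuousWithinAt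
  have hleft : IntegrableOn (fun x => |u x| ^ p * conformalFactor x ^ (m + 2)) B :=
    integrableOn_of_continuousOn_of_support_subset
      ((hu.continuous.abs.rpow_const fun _ => .inr hp0.le).continuousOn.mul (hρc.pow _)) hcs hsupp
      fun x hx => by_contra fun h => hx
        (by simp [image_eq_zero_of_notMem_tsupport h, Real.zero_rpow hp0.ne'])
  have hright : IntegrableOn (fun x => (conformalFactor x)⁻¹ ^ p * ‖fderiv ℝ u x‖ ^ p *
      conformalFactor x ^ (m + 2)) B :=
    integrableOn_of_continuousOn_of_support_subset
      ((((hρc.inv₀ fun x hx => (conformalFactor_pos (hB.1 hx)).ne').rpow_const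
        fun _ _ => .inr hp0.le).mul ((hu1.continuous_fderiv one_ne_zero).norm.rpow_const
          fun _ => .inr hp0.le).continuousOn).mul (hρc.pow _)) hcs hsupp
      fun x hx => by_contra fun h => hx (by
        have : fderiv ℝ u x = 0 := by_contra fun h' => h (support_fderiv_subset ℝ h')
        simp [this, Real.zero_rpow hp0.ne'])
  have hmono := setIntegral_mono_on hleft ((hright.const_mul ((p / (m + 1)) ^ p)).add
    (hdivi.const_mul (p / (m + 1)))) measurableSet_ball fun x hx =>
      le_add_divergence_smul_horosphericalField hm hp (hu1.differentiable one_ne_zero) hξ (hB.1 hx)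
  have hsplit := integral_add (hright.const_mul ((p / (m + 1)) ^ p))
    (hdivi.const_mul (p / (m + 1)))
  rw [integral_const_mul, integral_const_mul, hdiv, mul_zero, add_zero] at hsplit
  have hn1 : ((m + 2 : ℕ) : ℝ) - 1 = m + 1 := by push_cast; ring
  have hgrad : ∀ x, ‖gradient u x‖ = ‖fderiv ℝ u x‖ := fun x => by simp [gradient]
  simp only [hn1, hgrad]
  simpa only [conformalFactor, inv_div] using hmono.trans hsplit.le
end

section
/- Let n ≥ 2 be an integer, p > 1, and let φ(s) = (n ω_n)^{-p/(p-1)} ∫_s^∞ (sinh F(t))^{-p(n-1)/(p-1)} dt for s > 0 (which is finite). Then for every b > 0 one has φ(b) ≤ (n-1)^{-p/(p-1)} (p-1) b^{-1/(p-1)}. -/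
open MeasureTheory

/-- `ω_n`: the Lebesgue volume of the unit ball in `ℝ^n`. -/
noncomputable def unitBallVol (n : ℕ) : ℝ :=
  (volume (Metric.ball (0 : EuclideanSpace ℝ (Fin n)) 1)).toReal

/-- The function `φ(s) = (nω_n)^{-p/(p-1)} ∫_s^∞ (sinh F(t))^{-p(n-1)/(p-1)} dt`. -/
noncomputable def phiAux (n : ℕ) (p : ℝ) (F : ℝ → ℝ) (s : ℝ) : ℝ :=
  ((n : ℝ) * unitBallVol n) ^ (-(p / (p - 1))) *
    ∫ t in Set.Ioi s, Real.sinh (F t) ^ (-(p * ((n : ℝ) - 1) / (p - 1)))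

/-- The volume integral of hyperbolic space is controlled by the area of the bounding sphere. -/
theorem nat_mul_integral_sinh_pow_le (k : ℕ) {R : ℝ} (hR : 0 ≤ R) :
    (k : ℝ) * ∫ r in (0 : ℝ)..R, Real.sinh r ^ k ≤ Real.sinh R ^ k := by
  rcases Nat.eq_zero_or_pos k with rfl | hk
  · simp
  have hderiv : ∀ r ∈ Set.uIcc 0 R, HasDerivAt (fun r => Real.sinh r ^ k)
      ((k : ℝ) * Real.sinh r ^ (k - 1) * Real.cosh r) r :=
    fun r _ => (Real.hasDerivAt_sinh r).pow k
  have hcont : Continuous fun r => (k : ℝ) * Real.sinh r ^ (k - 1) * Real.cosh r := by fun_prop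
  have hftc := intervalIntegral.integral_eq_sub_of_hasDerivAt hderiv
    (hcont.intervalIntegrable 0 R)
  rw [Real.sinh_zero, zero_pow hk.ne', sub_zero] at hftc
  rw [← hftc, ← intervalIntegral.integral_const_mul]
  refine intervalIntegral.integral_mono_on hR
    (Continuous.intervalIntegrable (by fun_prop) 0 R) (hcont.intervalIntegrable 0 R) ?_
  intro r hr
  have hs : 0 ≤ Real.sinh r := Real.sinh_nonneg_iff.2 hr.1
  calc (k : ℝ) * Real.sinh r ^ k = k * Real.sinh r ^ (k - 1) * Real.sinh r := by
        rw [mul_assoc, ← pow_succ, Nat.sub_add_cancel hk]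
    _ ≤ k * Real.sinh r ^ (k - 1) * Real.cosh r := by
        gcongr
        exact (Real.sinh_lt_cosh r).le

/-- with `F` the inverse of `Φ(t) = nω_n ∫_0^t (sinh r)^{n-1} dr` and
`φ` as above, `φ(b) ≤ (n-1)^{-p/(p-1)} (p-1) b^{-1/(p-1)}` for every `b > 0`. -/
theorem phi_upper_bound (n : ℕ) (hn : 2 ≤ n) (p : ℝ) (hp : 1 < p)
    (F : ℝ → ℝ) (hF0 : ∀ s, 0 ≤ s → 0 ≤ F s)
    (hF : ∀ s, 0 ≤ s →
      s = n * unitBallVol n * ∫ r in (0 : ℝ)..(F s), Real.sinh r ^ (n - 1)) :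
    ∀ b > (0 : ℝ),
      phiAux n p F b ≤ (((n : ℝ) - 1)) ^ (-(p / (p - 1))) * (p - 1) * b ^ (-(1 / (p - 1))) := by
  intro b hb
  have hp1 : 0 < p - 1 := sub_pos.2 hp
  obtain ⟨C, hC⟩ : ∃ C, C = (n : ℝ) * unitBallVol n := ⟨_, rfl⟩
  obtain ⟨q, hq⟩ : ∃ q, q = p / (p - 1) := ⟨_, rfl⟩
  have hq1 : q = 1 + 1 / (p - 1) := by rw [hq]; field_simp; ring
  have hinv : 0 < 1 / (p - 1) := by positivity
  have hn1 : ((n - 1 : ℕ) : ℝ) = (n : ℝ) - 1 := by rw [Nat.cast_sub (by omega), Nat.cast_one]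
  have hn0 : (0 : ℝ) < (n : ℝ) - 1 := by rw [← hn1]; exact_mod_cast (by omega : 0 < n - 1)
  have hCpos : 0 < C := by
    refine lt_of_le_of_ne (hC ▸ mul_nonneg n.cast_nonneg ENNReal.toReal_nonneg) fun h => ?_
    have h1 := hF 1 zero_le_one
    rw [← hC, ← h, zero_mul] at h1
    exact one_ne_zero h1
  have hexp : -(p * ((n : ℝ) - 1) / (p - 1)) = ((n - 1 : ℕ) : ℝ) * (-q) := by
    rw [hn1, hq]; ring
  have hbound : ∀ t ∈ Set.Ioi b, Real.sinh (F t) ^ (-(p * ((n : ℝ) - 1) / (p - 1))) ≤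
      (((n : ℝ) - 1) / C) ^ (-q) * t ^ (-q) := by
    intro t ht
    have ht0 : 0 < t := hb.trans ht
    have hs : 0 ≤ Real.sinh (F t) := Real.sinh_nonneg_iff.2 (hF0 t ht0.le)
    have hle := nat_mul_integral_sinh_pow_le (n - 1) (hF0 t ht0.le)
    have hFt := hF t ht0.le
    rw [← hC] at hFt
    rw [hexp, Real.rpow_mul hs, Real.rpow_natCast, ← Real.mul_rpow (by positivity) ht0.le]
    refine Real.rpow_le_rpow_of_nonpos (by positivity) ?_ (by linarith)
    calc ((n : ℝ) - 1) / C * t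
        = ((n - 1 : ℕ) : ℝ) * ∫ r in (0 : ℝ)..(F t), Real.sinh r ^ (n - 1) := by
          rw [hn1]; nth_rewrite 1 [hFt]; field_simp
      _ ≤ _ := hle
  have hint : ∫ t in Set.Ioi b, Real.sinh (F t) ^ (-(p * ((n : ℝ) - 1) / (p - 1))) ≤
      ∫ t in Set.Ioi b, (((n : ℝ) - 1) / C) ^ (-q) * t ^ (-q) := by
    refine integral_mono_of_nonneg ?_ ?_ ?_
    · filter_upwards [ae_restrict_mem measurableSet_Ioi] with t ht
      exact Real.rpow_nonneg (Real.sinh_nonneg_iff.2 (hF0 t (hb.trans ht).le)) _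
    · exact (integrableOn_Ioi_rpow_of_lt (by linarith) hb).const_mul _
    · filter_upwards [ae_restrict_mem measurableSet_Ioi] with t ht using hbound t ht
  rw [integral_const_mul, integral_Ioi_rpow_of_lt (by linarith) hb] at hint
  unfold phiAux
  rw [← hC, ← hq]
  refine (mul_le_mul_of_nonneg_left hint (Real.rpow_nonneg hCpos.le _)).trans_eq ?_
  have hCq : C ^ (-q) ≠ 0 := (Real.rpow_pos_of_pos hCpos _).ne'
  have hq2 : -q + 1 = -(1 / (p - 1)) := by linarith
  rw [Real.div_rpow hn0.le hCpos.le, hq2]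
  field_simp
end

section
/- Let n ≥ 2 be an integer, p > 1, φ(s) = (n ω_n)^{-p/(p-1)} ∫_s^∞ (sinh F(t))^{-p(n-1)/(p-1)} dt, and let g : (0,∞) → [0,∞) be measurable with ∫_0^∞ g(s)^p ds < ∞. Then lim_{a→0⁺} a (∫_0^{φ(a)} g(t) dt)^p = 0 and lim_{b→∞} b (∫_0^{φ(b)} g(t) dt)^p = 0. -/
open MeasureTheory Filter

/-- `∫_0^x sinh^{k+1} ≤ sinh^{k+1} x` for `x ≥ 0`. -/
theorem integral_sinh_pow_succ_le (k : ℕ) {x : ℝ} (hx : 0 ≤ x) :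
    ∫ r in (0 : ℝ)..x, Real.sinh r ^ (k + 1) ≤ Real.sinh x ^ (k + 1) := by
  have hderiv : ∀ r ∈ Set.uIcc 0 x, HasDerivAt (fun r => Real.sinh r ^ (k + 1))
      (((k + 1 : ℕ) : ℝ) * Real.sinh r ^ k * Real.cosh r) r := fun r _ => by
    simpa using (Real.hasDerivAt_sinh r).fun_pow (k + 1)
  have hcont : Continuous fun r : ℝ => ((k + 1 : ℕ) : ℝ) * Real.sinh r ^ k * Real.cosh r := by
    fun_prop
  have hFTC := intervalIntegral.integral_eq_sub_of_hasDerivAt hderiv (hcont.intervalIntegrable 0 x)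
  simp only [Real.sinh_zero, ne_eq, Nat.add_eq_zero_iff, one_ne_zero, and_false,
    not_false_eq_true, zero_pow, sub_zero] at hFTC
  rw [← hFTC]
  refine intervalIntegral.integral_mono_on hx
    ((by fun_prop : Continuous fun r : ℝ => Real.sinh r ^ (k + 1)).intervalIntegrable 0 x)
    (hcont.intervalIntegrable 0 x) fun r hr => ?_
  have hs : 0 ≤ Real.sinh r ^ k := pow_nonneg (Real.sinh_nonneg_iff.2 hr.1) k
  have hk : (1 : ℝ) ≤ ((k + 1 : ℕ) : ℝ) := by simp
  calc Real.sinh r ^ (k + 1) = Real.sinh r ^ k * Real.sinh r := pow_succ _ _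
    _ ≤ Real.sinh r ^ k * Real.cosh r :=
        mul_le_mul_of_nonneg_left (Real.sinh_lt_cosh r).le hs
    _ ≤ ((k + 1 : ℕ) : ℝ) * (Real.sinh r ^ k * Real.cosh r) :=
        le_mul_of_one_le_left (mul_nonneg hs (Real.cosh_pos r).le) hk
    _ = _ := by ring

theorem unitBallVol_pos (n : ℕ) : 0 < unitBallVol n :=
  ENNReal.toReal_pos (Metric.measure_ball_pos _ _ one_pos).ne' measure_ball_lt_top.ne

/-- `φ(s) ≤ (p - 1) s^{-1/(p-1)}`, a consequence of `n ω_n (sinh F(t))^{n-1} ≥ t`. -/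
theorem phiAux_le {n : ℕ} (hn : 2 ≤ n) {p : ℝ} (hp : 1 < p) {F : ℝ → ℝ}
    (hF0 : ∀ s, 0 ≤ s → 0 ≤ F s)
    (hF : ∀ s, 0 ≤ s →
      s = n * unitBallVol n * ∫ r in (0 : ℝ)..(F s), Real.sinh r ^ (n - 1))
    {s : ℝ} (hs : 0 < s) :
    phiAux n p F s ≤ (p - 1) * s ^ (-(1 / (p - 1))) := by
  obtain ⟨k, rfl⟩ : ∃ k, n = k + 2 := ⟨n - 2, by omega⟩
  have hp1 : 0 < p - 1 := by linarith
  set c : ℝ := ((k + 2 : ℕ) : ℝ) * unitBallVol (k + 2)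
  have hc0 : 0 < c := mul_pos (by positivity) (unitBallVol_pos _)
  have hq : 1 < p / (p - 1) := by rw [lt_div_iff₀ hp1]; linarith
  have hq0 : -(p / (p - 1)) ≤ 0 := by linarith
  have hlow : ∀ t, 0 < t → t / c ≤ Real.sinh (F t) ^ (k + 1) := fun t ht => by
    rw [div_le_iff₀' hc0]
    calc t = c * ∫ r in (0 : ℝ)..(F t), Real.sinh r ^ (k + 1) := hF t ht.le
      _ ≤ _ := mul_le_mul_of_nonneg_left
        (integral_sinh_pow_succ_le k (hF0 t ht.le)) hc0.le
  have hsinh : ∀ t, 0 < t → 0 ≤ Real.sinh (F t) := fun t ht =>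
    Real.sinh_nonneg_iff.2 (hF0 t ht.le)
  have hpt : ∀ t, 0 < t →
      Real.sinh (F t) ^ (-(p * (((k + 2 : ℕ) : ℝ) - 1) / (p - 1)))
        ≤ c ^ (p / (p - 1)) * t ^ (-(p / (p - 1))) := fun t ht => by
    have hexp : -(p * (((k + 2 : ℕ) : ℝ) - 1) / (p - 1))
        = ((k + 1 : ℕ) : ℝ) * (-(p / (p - 1))) := by
      push_cast; ring
    rw [hexp, Real.rpow_mul (hsinh t ht), Real.rpow_natCast]
    calc (Real.sinh (F t) ^ (k + 1)) ^ (-(p / (p - 1))) ≤ (t / c) ^ (-(p / (p - 1))) :=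
          Real.rpow_le_rpow_of_nonpos (div_pos ht hc0) (hlow t ht) hq0
      _ = c ^ (p / (p - 1)) * t ^ (-(p / (p - 1))) := by
          rw [Real.div_rpow ht.le hc0.le, Real.rpow_neg hc0.le, div_inv_eq_mul, mul_comm]
  have hint := (integrableOn_Ioi_rpow_of_lt (a := -(p / (p - 1))) (by linarith) hs).const_mul
    (c ^ (p / (p - 1)))
  have hmono := integral_mono_of_nonneg
    (μ := volume.restrict (Set.Ioi s))
    (f := fun t => Real.sinh (F t) ^ (-(p * (((k + 2 : ℕ) : ℝ) - 1) / (p - 1))))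
    ((ae_restrict_mem measurableSet_Ioi).mono fun t (ht : s < t) =>
      Real.rpow_nonneg (hsinh t (hs.trans ht)) _) hint
    ((ae_restrict_mem measurableSet_Ioi).mono fun t (ht : s < t) => hpt t (hs.trans ht))
  rw [integral_const_mul, integral_Ioi_rpow_of_lt (by linarith) hs] at hmono
  have hexp : -(p / (p - 1)) + 1 = -(1 / (p - 1)) := by field_simp; ring
  rw [hexp] at hmono
  calc phiAux (k + 2) p F s ≤ c ^ (-(p / (p - 1))) *
        (c ^ (p / (p - 1)) * (-s ^ (-(1 / (p - 1))) / -(1 / (p - 1)))) :=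
        mul_le_mul_of_nonneg_left hmono (Real.rpow_nonneg hc0.le _)
    _ = (c ^ (-(p / (p - 1))) * c ^ (p / (p - 1))) * ((p - 1) * s ^ (-(1 / (p - 1)))) := by
        field_simp
    _ = (p - 1) * s ^ (-(1 / (p - 1))) := by
        rw [← Real.rpow_add hc0, neg_add_cancel, Real.rpow_zero, one_mul]

section PowerIntegrable

variable {p : ℝ} {g : ℝ → ℝ}

theorem memLp_of_integrableOn_rpow (hp : 1 < p) (hg : Measurable g) (hg0 : ∀ t, 0 ≤ g t)
    {A : Set ℝ} (hgp : IntegrableOn (fun s => g s ^ p) A) :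
    MemLp g (ENNReal.ofReal p) (volume.restrict A) := by
  have hp0 : 0 < p := by linarith
  rw [← integrable_norm_rpow_iff hg.aestronglyMeasurable (by simpa using hp0)
    ENNReal.ofReal_ne_top, ENNReal.toReal_ofReal hp0.le]
  simpa [IntegrableOn, abs_of_nonneg, hg0] using hgp

theorem integrableOn_of_integrableOn_rpow (hp : 1 < p) (hg : Measurable g) (hg0 : ∀ t, 0 ≤ g t)
    {A : Set ℝ} (hA : volume A ≠ ⊤) (hgp : IntegrableOn (fun s => g s ^ p) A) :
    IntegrableOn g A := by
  have : Fact (volume A < ⊤) := ⟨hA.lt_top⟩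
  exact (memLp_of_integrableOn_rpow hp hg hg0 hgp).integrable
    (by simpa using ENNReal.ofReal_le_ofReal hp.le)

/-- Hölder's inequality against the constant function `1` on a set of finite measure. -/
theorem setIntegral_le_rpow_mul_volume_rpow (hp : 1 < p) (hg : Measurable g)
    (hg0 : ∀ t, 0 ≤ g t) {A : Set ℝ} (hA : volume A ≠ ⊤)
    (hgp : IntegrableOn (fun s => g s ^ p) A) :
    ∫ t in A, g t ≤ (∫ t in A, g t ^ p) ^ (1 / p) * volume.real A ^ ((p - 1) / p) := by
  have : Fact (volume A < ⊤) := ⟨hA.lt_top⟩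
  have hpq := Real.HolderConjugate.conjExponent hp
  have h := integral_mul_le_Lp_mul_Lq_of_nonneg hpq
    (μ := volume.restrict A) (f := g) (g := fun _ => (1 : ℝ))
    (ae_of_all _ hg0) (ae_of_all _ fun _ => zero_le_one)
    (memLp_of_integrableOn_rpow hp hg hg0 hgp) (memLp_const 1)
  simpa [Real.conjExponent] using h

/-- Hölder's inequality on `(a, b)`, `0 ≤ a`. -/
theorem setIntegral_Ioc_le (hp : 1 < p) (hg : Measurable g) (hg0 : ∀ t, 0 ≤ g t)
    (hgp : IntegrableOn (fun s => g s ^ p) (Set.Ioi (0 : ℝ))) {a b : ℝ} (ha : 0 ≤ a)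
    (hab : a ≤ b) :
    ∫ t in Set.Ioc a b, g t ≤ (∫ t in Set.Ioc a b, g t ^ p) ^ (1 / p) * b ^ ((p - 1) / p) := by
  have h := setIntegral_le_rpow_mul_volume_rpow hp hg hg0 (A := Set.Ioc a b) (by simp)
    (hgp.mono_set fun t ht => ha.trans_lt ht.1)
  refine h.trans (mul_le_mul_of_nonneg_left ?_ (Real.rpow_nonneg
    (integral_nonneg fun t => Real.rpow_nonneg (hg0 t) _) _))
  rw [Real.volume_real_Ioc_of_le hab]
  exact Real.rpow_le_rpow (by linarith) (by linarith)
    (div_nonneg (by linarith) (by linarith))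

theorem tendsto_rpow_neg_mul_setIntegral_nhdsGT_zero (hp : 1 < p) (hg : Measurable g)
    (hg0 : ∀ t, 0 ≤ g t) (hgp : IntegrableOn (fun s => g s ^ p) (Set.Ioi (0 : ℝ))) :
    Tendsto (fun x : ℝ => x ^ (-((p - 1) / p)) * ∫ t in Set.Ioc 0 x, g t)
      (nhdsWithin 0 (Set.Ioi 0)) (nhds 0) := by
  have hlim : Tendsto (fun x : ℝ => (∫ t in Set.Ioc 0 x, g t ^ p) ^ (1 / p))
      (nhdsWithin 0 (Set.Ioi 0)) (nhds 0) := by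
    have hvol : Tendsto (fun x : ℝ => (volume.restrict (Set.Ioi (0 : ℝ))) (Set.Ioc 0 x))
        (nhdsWithin 0 (Set.Ioi 0)) (nhds 0) := by
      have h : Tendsto (fun x : ℝ => volume (Set.Ioc 0 x)) (nhdsWithin 0 (Set.Ioi 0)) (nhds 0) := by
        have : Tendsto ENNReal.ofReal (nhdsWithin 0 (Set.Ioi 0)) (nhds 0) := by
          simpa using (ENNReal.continuous_ofReal.tendsto 0).mono_left nhdsWithin_le_nhds
        simpa using this
      exact tendsto_of_tendsto_of_tendsto_of_le_of_le tendsto_const_nhds h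
        (fun _ => zero_le) fun x => Measure.restrict_apply_le _ _
    have h := hgp.tendsto_setIntegral_nhds_zero hvol
    have h' : Tendsto (fun x : ℝ => ∫ t in Set.Ioc 0 x, g t ^ p)
        (nhdsWithin 0 (Set.Ioi 0)) (nhds 0) := by
      refine h.congr fun x => ?_
      rw [Measure.restrict_restrict measurableSet_Ioc,
        Set.inter_eq_left.2 Set.Ioc_subset_Ioi_self]
    simpa [Real.zero_rpow, (by linarith : p ≠ 0)] using
      h'.rpow_const (p := 1 / p) (Or.inr (by positivity))
  refine squeeze_zero' ?_ ?_ hlim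
  · filter_upwards [self_mem_nhdsWithin] with x hx
    exact mul_nonneg (Real.rpow_nonneg (le_of_lt hx) _) (integral_nonneg hg0)
  · filter_upwards [self_mem_nhdsWithin] with x (hx : 0 < x)
    rw [Real.rpow_neg hx.le, inv_mul_le_iff₀ (Real.rpow_pos_of_pos hx _), mul_comm]
    exact setIntegral_Ioc_le hp hg hg0 hgp le_rfl hx.le

theorem tendsto_rpow_neg_mul_setIntegral_atTop (hp : 1 < p) (hg : Measurable g)
    (hg0 : ∀ t, 0 ≤ g t) (hgp : IntegrableOn (fun s => g s ^ p) (Set.Ioi (0 : ℝ))) :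
    Tendsto (fun x : ℝ => x ^ (-((p - 1) / p)) * ∫ t in Set.Ioc 0 x, g t) atTop (nhds 0) := by
  have hp0 : 0 < p := by linarith
  have hgp0 : ∀ t, 0 ≤ g t ^ p := fun t => Real.rpow_nonneg (hg0 t) _
  have htail : Tendsto (fun T : ℝ => (∫ t in Set.Ioi T, g t ^ p) ^ (1 / p)) atTop (nhds 0) := by
    have h := tendsto_setIntegral_of_antitone (μ := volume) (f := fun t => g t ^ p)
      (s := fun T : ℝ => Set.Ioi T) (fun T => measurableSet_Ioi)
      (fun a b hab => Set.Ioi_subset_Ioi hab) ⟨0, hgp⟩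
    have hempty : ⋂ T : ℝ, Set.Ioi T = ∅ := by
      ext t
      simpa using ⟨t, le_rfl⟩
    rw [hempty, setIntegral_empty] at h
    simpa [Real.zero_rpow, hp0.ne'] using h.rpow_const (p := 1 / p) (Or.inr (by positivity))
  have hpow : Tendsto (fun x : ℝ => x ^ (-((p - 1) / p))) atTop (nhds 0) :=
    tendsto_rpow_neg_atTop (div_pos (by linarith) hp0)
  refine tendsto_order.2 ⟨fun b hb => ?_, fun ε hε => ?_⟩
  · filter_upwards [eventually_ge_atTop 0] with x hx
    exact hb.trans_le (mul_nonneg (Real.rpow_nonneg hx _) (integral_nonneg hg0))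
  obtain ⟨T, hTε, hT0⟩ := ((htail.eventually (gt_mem_nhds (half_pos hε))).and
    (eventually_ge_atTop 0)).exists
  have hhead : Tendsto (fun x : ℝ => x ^ (-((p - 1) / p)) * ∫ t in Set.Ioc 0 T, g t)
      atTop (nhds 0) := by
    simpa using hpow.mul_const (∫ t in Set.Ioc 0 T, g t)
  filter_upwards [hhead.eventually (gt_mem_nhds (half_pos hε)), eventually_ge_atTop T,
    eventually_gt_atTop 0] with x hxhead hTx hx
  have hloc : ∀ a b : ℝ, 0 ≤ a → IntegrableOn g (Set.Ioc a b) := fun a b ha =>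
    integrableOn_of_integrableOn_rpow hp hg hg0 (by simp)
      (hgp.mono_set fun t ht => ha.trans_lt ht.1)
  have hsplit : ∫ t in Set.Ioc 0 x, g t
      = (∫ t in Set.Ioc 0 T, g t) + ∫ t in Set.Ioc T x, g t := by
    rw [← setIntegral_union (Set.Ioc_disjoint_Ioc_of_le le_rfl) measurableSet_Ioc (hloc 0 T le_rfl)
      (hloc T x hT0), Set.Ioc_union_Ioc_eq_Ioc hT0 hTx]
  have hmono : ∫ t in Set.Ioc T x, g t ^ p ≤ ∫ t in Set.Ioi T, g t ^ p :=
    setIntegral_mono_set (hgp.mono_set (Set.Ioi_subset_Ioi hT0)) (ae_of_all _ hgp0)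
      Set.Ioc_subset_Ioi_self.eventuallyLE
  have hfar : x ^ (-((p - 1) / p)) * ∫ t in Set.Ioc T x, g t
      ≤ (∫ t in Set.Ioi T, g t ^ p) ^ (1 / p) := by
    rw [Real.rpow_neg hx.le, inv_mul_le_iff₀ (Real.rpow_pos_of_pos hx _), mul_comm]
    exact (setIntegral_Ioc_le hp hg hg0 hgp hT0 hTx).trans <|
      mul_le_mul_of_nonneg_right (Real.rpow_le_rpow (integral_nonneg hgp0) hmono (by positivity))
        (Real.rpow_nonneg hx.le _)
  rw [hsplit, mul_add]
  linarith

/-- If `y ≤ x = (p - 1) s^{-1/(p-1)}`, then `s (∫_0^y g)^p` is at most a constant times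
`(x^{-(p-1)/p} ∫_0^x g)^p`. -/
theorem mul_setIntegral_rpow_le (hp : 1 < p) (hg : Measurable g)
    (hg0 : ∀ t, 0 ≤ g t) (hgp : IntegrableOn (fun s => g s ^ p) (Set.Ioi (0 : ℝ)))
    {s x y : ℝ} (hs : 0 < s) (hx : x = (p - 1) * s ^ (-(1 / (p - 1)))) (hyx : y ≤ x) :
    s * (∫ t in Set.Ioo 0 y, g t) ^ p
      ≤ (p - 1) ^ (p - 1) * (x ^ (-((p - 1) / p)) * ∫ t in Set.Ioc 0 x, g t) ^ p := by
  have hp0 : 0 < p := by linarith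
  have hp1 : 0 < p - 1 := by linarith
  have hsx : s = (p - 1) ^ (p - 1) * x ^ (-(p - 1)) := by
    rw [hx, Real.mul_rpow hp1.le (Real.rpow_nonneg hs.le _), ← mul_assoc, ← Real.rpow_add hp1,
      ← Real.rpow_mul hs.le]
    have : -(1 / (p - 1)) * -(p - 1) = 1 := by field_simp
    rw [this]
    simp
  have hx0 : 0 < x := hx ▸ mul_pos hp1 (Real.rpow_pos_of_pos hs _)
  have hmono : ∫ t in Set.Ioo 0 y, g t ≤ ∫ t in Set.Ioc 0 x, g t :=
    setIntegral_mono_set (integrableOn_of_integrableOn_rpow hp hg hg0 (by simp)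
      (hgp.mono_set fun t ht => ht.1)) (ae_of_all _ hg0)
      (Set.Ioo_subset_Ioc_self.trans (Set.Ioc_subset_Ioc_right hyx)).eventuallyLE
  have hexp : -((p - 1) / p) * p = -(p - 1) := by field_simp
  rw [Real.mul_rpow (Real.rpow_nonneg hx0.le _) (integral_nonneg hg0), ← Real.rpow_mul hx0.le,
    hexp, ← mul_assoc, ← hsx]
  exact mul_le_mul_of_nonneg_left
    (Real.rpow_le_rpow (integral_nonneg hg0) hmono hp0.le) hs.le

end PowerIntegrable

/-- with `F` the inverse of `Φ(t) = nω_n ∫_0^t (sinh r)^{n-1} dr`, `φ`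
as above, and `g ≥ 0` measurable with `∫_0^∞ g^p < ∞`, one has
`a (∫_0^{φ(a)} g)^p → 0` as `a → 0⁺` and `b (∫_0^{φ(b)} g)^p → 0` as `b → ∞`. -/
theorem boundary_terms_vanish (n : ℕ) (hn : 2 ≤ n) (p : ℝ) (hp : 1 < p)
    (F : ℝ → ℝ) (hF0 : ∀ s, 0 ≤ s → 0 ≤ F s)
    (hF : ∀ s, 0 ≤ s →
      s = n * unitBallVol n * ∫ r in (0 : ℝ)..(F s), Real.sinh r ^ (n - 1))
    (g : ℝ → ℝ) (hg : Measurable g) (hg0 : ∀ t, 0 ≤ g t)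
    (hgp : IntegrableOn (fun s => g s ^ p) (Set.Ioi (0 : ℝ))) :
    Tendsto (fun a : ℝ => a * (∫ t in Set.Ioo (0 : ℝ) (phiAux n p F a), g t) ^ p)
      (nhdsWithin 0 (Set.Ioi 0)) (nhds 0)
    ∧ Tendsto (fun b : ℝ => b * (∫ t in Set.Ioo (0 : ℝ) (phiAux n p F b), g t) ^ p)
      atTop (nhds 0) := by
  have hp0 : 0 < p := by linarith
  have hp1 : 0 < p - 1 := by linarith
  have key : ∀ {l l' : Filter ℝ}, (∀ᶠ s in l, 0 < s) →
      Tendsto (fun s : ℝ => (p - 1) * s ^ (-(1 / (p - 1)))) l l' →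
      Tendsto (fun x : ℝ => x ^ (-((p - 1) / p)) * ∫ t in Set.Ioc 0 x, g t) l' (nhds 0) →
      Tendsto (fun s : ℝ => s * (∫ t in Set.Ioo (0 : ℝ) (phiAux n p F s), g t) ^ p)
        l (nhds 0) := fun hl hx hlim => by
    have h := ((hlim.comp hx).rpow_const (p := p) (Or.inr hp0.le)).const_mul ((p - 1) ^ (p - 1))
    rw [Real.zero_rpow hp0.ne', mul_zero] at h
    refine squeeze_zero' ?_ ?_ h
    · filter_upwards [hl] with s hs
      exact mul_nonneg hs.le (Real.rpow_nonneg (integral_nonneg hg0) _)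
    · filter_upwards [hl] with s hs
      exact mul_setIntegral_rpow_le hp hg hg0 hgp hs rfl (phiAux_le hn hp hF0 hF hs)
  have hneg : -(1 / (p - 1)) < 0 := neg_lt_zero.2 (by positivity)
  refine ⟨key self_mem_nhdsWithin
      ((tendsto_rpow_neg_nhdsGT_zero hneg).const_mul_atTop hp1)
      (tendsto_rpow_neg_mul_setIntegral_atTop hp hg hg0 hgp),
    key (eventually_gt_atTop 0) ?_ (tendsto_rpow_neg_mul_setIntegral_nhdsGT_zero hp hg hg0 hgp)⟩
  refine tendsto_nhdsWithin_iff.2 ⟨?_, ?_⟩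
  · simpa using (tendsto_rpow_neg_atTop (y := 1 / (p - 1)) (by positivity)).const_mul (p - 1)
  · filter_upwards [eventually_gt_atTop 0] with s hs
    exact mul_pos hp1 (Real.rpow_pos_of_pos hs _)
end

section
/- Let n ≥ 2 be an integer and p > 1 with p' = p/(p-1). Let f : (0,∞) → [0,∞) be nonincreasing and measurable with ∫_0^∞ f(s)^p ds ≤ 1, let f^{**}(s) = (1/s) ∫_0^s f(t) dt be its maximal function, and define h(s) = ∫_s^∞ t f^{**}(t) / (n ω_n (sinh F(t))^{n-1})² dt for s > 0. Then (∫_0^∞ h(s)^p ds)^{1/p} < p p'/(n-1)². -/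
open MeasureTheory

open Set ENNReal

/-- **Schur's test** with weights `u`, `v`: a nonnegative kernel that maps `u ^ q` below `C * v ^ q`,
and whose transpose maps `v ^ p` below `C * u ^ p`, has `L^p` operator norm at most `C`. -/
theorem lintegral_rpow_lintegral_mul_le_of_schur {α β : Type*} [MeasurableSpace α]
    [MeasurableSpace β] {μ : Measure α} {ν : Measure β} [SFinite μ] [SFinite ν] {p q : ℝ}
    (hpq : p.HolderConjugate q) {k : α → β → ℝ≥0∞} (hk : Measurable (Function.uncurry k))
    {u : β → ℝ≥0∞} (hu : Measurable u) (hu0 : ∀ᵐ y ∂ν, u y ≠ 0 ∧ u y ≠ ∞)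
    {v : α → ℝ≥0∞} (hv : Measurable v) {C : ℝ≥0∞}
    (h₁ : ∀ᵐ x ∂μ, ∫⁻ y, k x y * u y ^ q ∂ν ≤ C * v x ^ q)
    (h₂ : ∀ᵐ y ∂ν, ∫⁻ x, k x y * v x ^ p ∂μ ≤ C * u y ^ p)
    {φ : β → ℝ≥0∞} (hφ : Measurable φ) :
    ∫⁻ x, (∫⁻ y, k x y * φ y ∂ν) ^ p ∂μ ≤ C ^ p * ∫⁻ y, φ y ^ p ∂ν := by
  have hp := hpq.pos
  have hq := hpq.symm.pos
  have hkx : ∀ x, Measurable (k x) := fun x => hk.comp measurable_prodMk_left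
  have hky : ∀ y, Measurable fun x => k x y := fun y => hk.comp measurable_prodMk_right
  have hsum : 1 / p + 1 / q = 1 := by simpa using hpq.inv_add_inv_eq_one
  have hexp : (1 / q) * p = p - 1 := by
    have := hpq.sub_one_mul_conj
    field_simp
    linarith
  have hexp' : q * (p - 1) = p := by
    rw [mul_comm]; exact hpq.sub_one_mul_conj
  have holder : ∀ x, (∫⁻ y, k x y * φ y ∂ν) ^ p ≤
      (∫⁻ y, k x y * (φ y / u y) ^ p ∂ν) * (∫⁻ y, k x y * u y ^ q ∂ν) ^ (p - 1) := by
    intro x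
    have hle := ENNReal.lintegral_mul_le_Lp_mul_Lq ν hpq
      (f := fun y => k x y ^ (1 / p) * (φ y / u y)) (g := fun y => k x y ^ (1 / q) * u y)
      (((hkx x).pow_const _).mul (hφ.div hu)).aemeasurable
      (((hkx x).pow_const _).mul hu).aemeasurable
    have e₀ : ∫⁻ y, k x y * φ y ∂ν = ∫⁻ y, ((fun y => k x y ^ (1 / p) * (φ y / u y)) *
        fun y => k x y ^ (1 / q) * u y) y ∂ν := by
      refine lintegral_congr_ae ?_
      filter_upwards [hu0] with y hy
      simp only [Pi.mul_apply]
      rw [mul_mul_mul_comm, ← ENNReal.rpow_add_of_nonneg _ _ (by positivity) (by positivity),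
        hsum, ENNReal.rpow_one, ENNReal.div_mul_cancel hy.1 hy.2]
    have e₁ : ∀ y, (k x y ^ (1 / p) * (φ y / u y)) ^ p = k x y * (φ y / u y) ^ p := by
      intro y
      rw [ENNReal.mul_rpow_of_nonneg _ _ hp.le, ← ENNReal.rpow_mul, one_div_mul_cancel hp.ne',
        ENNReal.rpow_one]
    have e₂ : ∀ y, (k x y ^ (1 / q) * u y) ^ q = k x y * u y ^ q := by
      intro y
      rw [ENNReal.mul_rpow_of_nonneg _ _ hq.le, ← ENNReal.rpow_mul, one_div_mul_cancel hq.ne',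
        ENNReal.rpow_one]
    rw [← e₀] at hle
    simp only [e₁, e₂] at hle
    refine (ENNReal.rpow_le_rpow hle hp.le).trans_eq ?_
    rw [ENNReal.mul_rpow_of_nonneg _ _ hp.le, ← ENNReal.rpow_mul, ← ENNReal.rpow_mul, hexp,
      one_div_mul_cancel hp.ne', ENNReal.rpow_one]
  have hp1 : 0 ≤ p - 1 := hpq.sub_one_pos.le
  have hmeas : Measurable (Function.uncurry fun x y =>
      k x y * (φ y / u y) ^ p * (C ^ (p - 1) * v x ^ p)) := by
    refine (hk.mul ?_).mul ?_
    · exact ((hφ.div hu).pow_const p).comp measurable_snd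
    · exact ((hv.pow_const p).const_mul _).comp measurable_fst
  calc ∫⁻ x, (∫⁻ y, k x y * φ y ∂ν) ^ p ∂μ
      ≤ ∫⁻ x, ∫⁻ y, k x y * (φ y / u y) ^ p * (C ^ (p - 1) * v x ^ p) ∂ν ∂μ := by
        refine lintegral_mono_ae ?_
        filter_upwards [h₁] with x hx
        refine (holder x).trans ?_
        rw [lintegral_mul_const _ (by fun_prop)]
        gcongr
        refine (ENNReal.rpow_le_rpow hx hp1).trans_eq ?_
        rw [ENNReal.mul_rpow_of_nonneg _ _ hp1, ← ENNReal.rpow_mul, hexp']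
    _ = ∫⁻ y, ∫⁻ x, k x y * (φ y / u y) ^ p * (C ^ (p - 1) * v x ^ p) ∂μ ∂ν :=
        lintegral_lintegral_swap hmeas.aemeasurable
    _ = ∫⁻ y, (C ^ (p - 1) * (φ y / u y) ^ p) * ∫⁻ x, k x y * v x ^ p ∂μ ∂ν := by
        refine lintegral_congr fun y => ?_
        rw [← lintegral_const_mul _ (by fun_prop)]
        refine lintegral_congr fun x => ?_
        ring
    _ ≤ ∫⁻ y, C ^ p * φ y ^ p ∂ν := by
        refine lintegral_mono_ae ?_
        filter_upwards [h₂, hu0] with y hy hy0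
        calc (C ^ (p - 1) * (φ y / u y) ^ p) * ∫⁻ x, k x y * v x ^ p ∂μ
            ≤ (C ^ (p - 1) * (φ y / u y) ^ p) * (C * u y ^ p) := by gcongr
          _ = (C ^ (p - 1) * C ^ (1 : ℝ)) * ((φ y / u y) ^ p * u y ^ p) := by
              rw [ENNReal.rpow_one]; ring
          _ = C ^ p * φ y ^ p := by
              rw [← ENNReal.rpow_add_of_nonneg _ _ hp1 zero_le_one, sub_add_cancel,
                ← ENNReal.mul_rpow_of_nonneg _ _ hp.le, ENNReal.div_mul_cancel hy0.1 hy0.2]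
    _ = C ^ p * ∫⁻ y, φ y ^ p ∂ν := lintegral_const_mul _ (hφ.pow_const p)

theorem lintegral_Ioo_zero_rpow_neg {a t : ℝ} (ha : a < 1) (ht : 0 < t) :
    ∫⁻ x in Ioo 0 t, ENNReal.ofReal (x ^ (-a)) = ENNReal.ofReal (t ^ (1 - a) / (1 - a)) := by
  have hint : IntervalIntegrable (fun x : ℝ => x ^ (-a)) volume 0 t :=
    intervalIntegral.intervalIntegrable_rpow' (by linarith)
  rw [restrict_Ioo_eq_restrict_Ioc, ← ofReal_integral_eq_lintegral_ofReal,
    ← intervalIntegral.integral_of_le ht.le, integral_rpow (Or.inl (by linarith)),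
    Real.zero_rpow (by linarith), sub_zero, neg_add_eq_sub]
  · exact (intervalIntegrable_iff_integrableOn_Ioc_of_le ht.le).1 hint
  · filter_upwards [ae_restrict_mem measurableSet_Ioc] with x hx
    exact Real.rpow_nonneg hx.1.le _

theorem lintegral_Ioi_rpow_neg_one_sub {b t : ℝ} (hb : 0 < b) (ht : 0 < t) :
    ∫⁻ x in Ioi t, ENNReal.ofReal (x ^ (-1 - b)) = ENNReal.ofReal (t ^ (-b) / b) := by
  rw [← ofReal_integral_eq_lintegral_ofReal, integral_Ioi_rpow_of_lt (by linarith) ht]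
  · congr 1
    rw [show -1 - b + 1 = -b by ring, neg_div_neg_eq]
  · exact integrableOn_Ioi_rpow_of_lt (by linarith) ht
  · filter_upwards [ae_restrict_mem measurableSet_Ioi] with x hx
    exact Real.rpow_nonneg (ht.trans hx).le _

/-- The Hardy averaging operator on `(0, ∞)`. -/
noncomputable def hardyAverage (φ : ℝ → ℝ≥0∞) (t : ℝ) : ℝ≥0∞ :=
  ENNReal.ofReal (1 / t) * ∫⁻ τ in Ioo 0 t, φ τ

/-- The formal adjoint of the Hardy averaging operator on `(0, ∞)`. -/
noncomputable def hardyAdjoint (φ : ℝ → ℝ≥0∞) (s : ℝ) : ℝ≥0∞ :=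
  ∫⁻ t in Ioi s, ENNReal.ofReal (1 / t) * φ t

theorem measurable_hardyAverage (φ : ℝ → ℝ≥0∞) : Measurable (hardyAverage φ) := by
  have hmono : Monotone fun t : ℝ => ∫⁻ τ in Ioo 0 t, φ τ := fun a b hab =>
    lintegral_mono_set (Ioo_subset_Ioo_right hab)
  exact (measurable_const.div measurable_id).ennreal_ofReal.mul hmono.measurable

theorem measurable_hardyAdjoint (φ : ℝ → ℝ≥0∞) : Measurable (hardyAdjoint φ) := by
  have hanti : Antitone (hardyAdjoint φ) := fun a b hab =>
    lintegral_mono_set (Ioi_subset_Ioi hab)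
  exact hanti.measurable

theorem lintegral_Ioi_indicator_Iio {t : ℝ} (g : ℝ → ℝ≥0∞) :
    ∫⁻ x in Ioi 0, (Iio t).indicator g x = ∫⁻ x in Ioo 0 t, g x := by
  rw [lintegral_indicator measurableSet_Iio, Measure.restrict_restrict measurableSet_Iio,
    inter_comm, Ioi_inter_Iio]

theorem lintegral_Ioi_indicator_Ioi {t : ℝ} (ht : 0 ≤ t) (g : ℝ → ℝ≥0∞) :
    ∫⁻ x in Ioi 0, (Ioi t).indicator g x = ∫⁻ x in Ioi t, g x := by
  rw [lintegral_indicator measurableSet_Ioi, Measure.restrict_restrict measurableSet_Ioi,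
    Ioi_inter_Ioi, sup_eq_left.2 ht]

theorem ofReal_rpow_rpow {x a b c : ℝ} (hx : 0 < x) (h : a * b = c) :
    ENNReal.ofReal (x ^ a) ^ b = ENNReal.ofReal (x ^ c) := by
  rw [ENNReal.ofReal_rpow_of_pos (Real.rpow_pos_of_pos hx _), ← Real.rpow_mul hx.le, h]

theorem measurable_ofReal_rpow (a : ℝ) : Measurable fun x : ℝ => ENNReal.ofReal (x ^ a) :=
  (measurable_id.pow_const a).ennreal_ofReal

theorem ae_Ioi_ofReal_rpow_ne (a : ℝ) : ∀ᵐ x ∂volume.restrict (Ioi (0 : ℝ)),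
    ENNReal.ofReal (x ^ a) ≠ 0 ∧ ENNReal.ofReal (x ^ a) ≠ ∞ := by
  filter_upwards [ae_restrict_mem measurableSet_Ioi] with x hx
  exact ⟨(ENNReal.ofReal_pos.2 (Real.rpow_pos_of_pos hx _)).ne', ENNReal.ofReal_ne_top⟩

theorem ofReal_one_div_mul_lintegral_Ioo_rpow_neg {a t : ℝ} (ha : a < 1) (ht : 0 < t) :
    ENNReal.ofReal (1 / t) * ∫⁻ x in Ioo 0 t, ENNReal.ofReal (x ^ (-a)) =
      ENNReal.ofReal (1 / (1 - a)) * ENNReal.ofReal (t ^ (-a)) := by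
  rw [lintegral_Ioo_zero_rpow_neg ha ht, ← ENNReal.ofReal_mul (by positivity),
    ← ENNReal.ofReal_mul (one_div_nonneg.2 (by linarith)), sub_eq_add_neg 1 a,
    Real.rpow_add ht, Real.rpow_one]
  congr 1
  field_simp

theorem lintegral_Ioi_ofReal_one_div_mul_rpow_neg {b t : ℝ} (hb : 0 < b) (ht : 0 < t) :
    ∫⁻ x in Ioi t, ENNReal.ofReal (1 / x) * ENNReal.ofReal (x ^ (-b)) =
      ENNReal.ofReal (1 / b) * ENNReal.ofReal (t ^ (-b)) := by
  rw [← ENNReal.ofReal_mul (by positivity), one_div_mul_eq_div,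
    ← lintegral_Ioi_rpow_neg_one_sub hb ht]
  refine setLIntegral_congr_fun measurableSet_Ioi fun x hx => ?_
  have hx0 : 0 < x := ht.trans hx
  rw [← ENNReal.ofReal_mul (by positivity), sub_eq_add_neg, Real.rpow_add hx0,
    Real.rpow_neg_one, one_div]

/-- The integral kernel of the Hardy averaging operator. -/
noncomputable def hardyKernel (t τ : ℝ) : ℝ≥0∞ :=
  (Iio t).indicator (fun _ => ENNReal.ofReal (1 / t)) τ

theorem measurable_uncurry_hardyKernel : Measurable (Function.uncurry hardyKernel) := by
  have : Function.uncurry hardyKernel = {z : ℝ × ℝ | z.2 < z.1}.indicator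
      fun z => ENNReal.ofReal (1 / z.1) := by
    ext z; simp [hardyKernel, Function.uncurry, indicator]
  rw [this]
  exact (measurable_const.div measurable_fst).ennreal_ofReal.indicator
    (measurableSet_lt measurable_snd measurable_fst)

theorem lintegral_hardyKernel_mul {g : ℝ → ℝ≥0∞} (hg : Measurable g) (t : ℝ) :
    ∫⁻ τ in Ioi 0, hardyKernel t τ * g τ = hardyAverage g t := by
  rw [hardyAverage, ← lintegral_const_mul _ hg, ← lintegral_Ioi_indicator_Iio]
  simp only [hardyKernel, indicator_mul_left]

theorem lintegral_hardyKernel_mul_left {τ : ℝ} (hτ : 0 < τ) (g : ℝ → ℝ≥0∞) :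
    ∫⁻ t in Ioi 0, hardyKernel t τ * g t = hardyAdjoint g τ := by
  rw [hardyAdjoint, ← lintegral_Ioi_indicator_Ioi hτ.le]
  refine lintegral_congr fun t => ?_
  simp [hardyKernel, indicator]

theorem lintegral_hardyKernel_mul_rpow_rpow {p q t : ℝ} (hpq : p.HolderConjugate q)
    (ht : 0 < t) :
    ∫⁻ τ in Ioi 0, hardyKernel t τ * ENNReal.ofReal (τ ^ (-(p⁻¹ * q⁻¹))) ^ q =
      ENNReal.ofReal q * ENNReal.ofReal (t ^ (-(p⁻¹ * q⁻¹))) ^ q := by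
  have hq := hpq.symm.pos
  have hexp : -(p⁻¹ * q⁻¹) * q = -p⁻¹ := by field_simp
  have h := ofReal_one_div_mul_lintegral_Ioo_rpow_neg (inv_lt_one_of_one_lt₀ hpq.lt) ht
  rw [hpq.one_sub_inv, one_div q⁻¹, inv_inv] at h
  rw [lintegral_hardyKernel_mul ((measurable_ofReal_rpow _).pow_const q), hardyAverage,
    ofReal_rpow_rpow ht hexp, ← h]
  exact congrArg _ (setLIntegral_congr_fun measurableSet_Ioo fun x hx =>
    ofReal_rpow_rpow hx.1 hexp)

theorem lintegral_hardyKernel_mul_rpow_rpow_left {p q τ : ℝ} (hpq : p.HolderConjugate q)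
    (hτ : 0 < τ) :
    ∫⁻ t in Ioi 0, hardyKernel t τ * ENNReal.ofReal (t ^ (-(p⁻¹ * q⁻¹))) ^ p =
      ENNReal.ofReal q * ENNReal.ofReal (τ ^ (-(p⁻¹ * q⁻¹))) ^ p := by
  have hp := hpq.pos
  have hexp : -(p⁻¹ * q⁻¹) * p = -q⁻¹ := by field_simp
  have h := lintegral_Ioi_ofReal_one_div_mul_rpow_neg (inv_pos.2 hpq.symm.pos) hτ
  rw [one_div, inv_inv] at h
  rw [lintegral_hardyKernel_mul_left hτ, hardyAdjoint, ofReal_rpow_rpow hτ hexp, ← h]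
  exact setLIntegral_congr_fun measurableSet_Ioi fun x hx =>
    congrArg _ (ofReal_rpow_rpow (hτ.trans hx) hexp)

/-- **Hardy's inequality**. -/
theorem lintegral_hardyAverage_rpow_le {p q : ℝ} (hpq : p.HolderConjugate q) {φ : ℝ → ℝ≥0∞}
    (hφ : Measurable φ) :
    ∫⁻ t in Ioi (0 : ℝ), hardyAverage φ t ^ p ≤
      ENNReal.ofReal q ^ p * ∫⁻ t in Ioi (0 : ℝ), φ t ^ p := by
  simp only [← lintegral_hardyKernel_mul hφ]
  refine lintegral_rpow_lintegral_mul_le_of_schur hpq measurable_uncurry_hardyKernel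
    (measurable_ofReal_rpow (-(p⁻¹ * q⁻¹))) (ae_Ioi_ofReal_rpow_ne _)
    (measurable_ofReal_rpow (-(p⁻¹ * q⁻¹))) ?_ ?_ hφ
  · filter_upwards [ae_restrict_mem measurableSet_Ioi] with t ht
    exact (lintegral_hardyKernel_mul_rpow_rpow hpq ht).le
  · filter_upwards [ae_restrict_mem measurableSet_Ioi] with t ht
    exact (lintegral_hardyKernel_mul_rpow_rpow_left hpq ht).le

/-- The **dual Hardy inequality**. -/
theorem lintegral_hardyAdjoint_rpow_le {p q : ℝ} (hpq : p.HolderConjugate q) {φ : ℝ → ℝ≥0∞}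
    (hφ : Measurable φ) :
    ∫⁻ s in Ioi (0 : ℝ), hardyAdjoint φ s ^ p ≤
      ENNReal.ofReal p ^ p * ∫⁻ t in Ioi (0 : ℝ), φ t ^ p := by
  rw [← setLIntegral_congr_fun measurableSet_Ioi fun s hs =>
    congrArg (· ^ p) (lintegral_hardyKernel_mul_left hs φ)]
  refine lintegral_rpow_lintegral_mul_le_of_schur hpq
    (k := fun s t => hardyKernel t s) (measurable_uncurry_hardyKernel.comp measurable_swap)
    (measurable_ofReal_rpow (-(q⁻¹ * p⁻¹))) (ae_Ioi_ofReal_rpow_ne _)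
    (measurable_ofReal_rpow (-(q⁻¹ * p⁻¹))) ?_ ?_ hφ
  · filter_upwards [ae_restrict_mem measurableSet_Ioi] with t ht
    exact (lintegral_hardyKernel_mul_rpow_rpow_left hpq.symm ht).le
  · filter_upwards [ae_restrict_mem measurableSet_Ioi] with t ht
    exact (lintegral_hardyKernel_mul_rpow_rpow hpq.symm ht).le

theorem mul_integral_sinh_pow_lt {m : ℕ} (hm : 1 ≤ m) {ρ : ℝ} (hρ : 0 < ρ) :
    m * ∫ r in (0 : ℝ)..ρ, Real.sinh r ^ m < Real.sinh ρ ^ m := by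
  have hftc : ∫ r in (0 : ℝ)..ρ, m * Real.sinh r ^ (m - 1) * Real.cosh r = Real.sinh ρ ^ m := by
    rw [intervalIntegral.integral_eq_sub_of_hasDerivAt (f := fun r => Real.sinh r ^ m)
      (fun r _ => (Real.hasDerivAt_sinh r).pow m)
      (Continuous.intervalIntegrable (by fun_prop) _ _)]
    simp [show m ≠ 0 by omega]
  rw [← hftc, ← intervalIntegral.integral_const_mul]
  have hlt : ∀ r, 0 < r → m * Real.sinh r ^ m < m * Real.sinh r ^ (m - 1) * Real.cosh r := by
    intro r hr
    have hs : 0 < Real.sinh r := Real.sinh_pos_iff.2 hr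
    have hm' : (0 : ℝ) < m := by exact_mod_cast hm
    obtain ⟨j, rfl⟩ : ∃ j, m = j + 1 := ⟨m - 1, by omega⟩
    rw [Nat.add_sub_cancel, pow_succ, ← mul_assoc]
    exact mul_lt_mul_of_pos_left (Real.sinh_lt_cosh r) (by positivity)
  refine intervalIntegral.integral_lt_integral_of_continuousOn_of_le_of_exists_lt hρ
    (by fun_prop) (by fun_prop) (fun r hr => (hlt r hr.1).le)
    ⟨ρ, right_mem_Icc.2 hρ.le, hlt ρ hρ⟩

theorem sub_one_mul_lt_of_inverse {n : ℕ} (hn : 2 ≤ n) {F : ℝ → ℝ} (hF0 : ∀ s, 0 ≤ s → 0 ≤ F s)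
    (hF : ∀ s, 0 ≤ s →
      s = n * unitBallVol n * ∫ r in (0 : ℝ)..(F s), Real.sinh r ^ (n - 1))
    {t : ℝ} (ht : 0 < t) :
    ((n : ℝ) - 1) * t < n * unitBallVol n * Real.sinh (F t) ^ (n - 1) := by
  have hFt : 0 < F t := by
    refine (hF0 t ht.le).lt_of_ne fun h => ht.ne' ?_
    rw [hF t ht.le, ← h]
    simp
  have hω : 0 < n * unitBallVol n := by
    refine lt_of_le_of_ne (mul_nonneg n.cast_nonneg ENNReal.toReal_nonneg) fun h => ht.ne' ?_
    rw [hF t ht.le, ← h, zero_mul]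
  have h := mul_lt_mul_of_pos_left (mul_integral_sinh_pow_lt (m := n - 1) (by omega) hFt) hω
  have hcast : ((n - 1 : ℕ) : ℝ) = (n : ℝ) - 1 := by
    rw [Nat.cast_sub (by omega), Nat.cast_one]
  calc ((n : ℝ) - 1) * t
      = n * unitBallVol n * (((n - 1 : ℕ) : ℝ) * ∫ r in (0 : ℝ)..(F t), Real.sinh r ^ (n - 1)) := by
        conv_lhs => rw [hF t ht.le]
        rw [hcast]; ring
    _ < _ := h

theorem ofReal_integral_le_lintegral_ofReal {α : Type*} [MeasurableSpace α] {μ : Measure α}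
    {g : α → ℝ} (hg : 0 ≤ᵐ[μ] g) :
    ENNReal.ofReal (∫ x, g x ∂μ) ≤ ∫⁻ x, ENNReal.ofReal (g x) ∂μ := by
  by_cases hi : Integrable g μ
  · exact (ofReal_integral_eq_lintegral_ofReal hi hg).le
  · simp [integral_undef hi]

/-- with `F` the inverse of `Φ(t) = nω_n ∫_0^t (sinh r)^{n-1} dr`, let
`f ≥ 0` be nonincreasing and measurable on `(0,∞)` with `∫_0^∞ f^p ≤ 1`, let
`f**(s) = (1/s)∫_0^s f` and `h(s) = ∫_s^∞ t f**(t)/(nω_n (sinh F(t))^{n-1})² dt`.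
Then `(∫_0^∞ h^p)^{1/p} < p p'/(n-1)²`. -/
theorem two_dim_sharp_strict_bound (n : ℕ) (hn : 2 ≤ n) (p : ℝ) (hp : 1 < p)
    (F : ℝ → ℝ) (hF0 : ∀ s, 0 ≤ s → 0 ≤ F s)
    (hF : ∀ s, 0 ≤ s →
      s = n * unitBallVol n * ∫ r in (0 : ℝ)..(F s), Real.sinh r ^ (n - 1))
    (f : ℝ → ℝ) (hf : Measurable f) (hf0 : ∀ t, 0 ≤ f t)
    (hmono : ∀ s t : ℝ, 0 < s → s ≤ t → f t ≤ f s)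
    (hfp : ∫⁻ s in Set.Ioi (0 : ℝ), ENNReal.ofReal (f s ^ p) ≤ 1) :
    (∫⁻ s in Set.Ioi (0 : ℝ),
        ENNReal.ofReal ((∫ t in Set.Ioi s,
          t * ((1 / t) * ∫ τ in Set.Ioo (0 : ℝ) t, f τ) /
            (n * unitBallVol n * Real.sinh (F t) ^ (n - 1)) ^ 2) ^ p)) ^ (1 / p)
      < ENNReal.ofReal (p * (p / (p - 1)) / ((n : ℝ) - 1) ^ 2) := by
  set q : ℝ := p / (p - 1) with hq_def
  have hpq : p.HolderConjugate q := Real.HolderConjugate.conjExponent hp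
  have hp0 := hpq.pos
  have hq0 := hpq.symm.pos
  have hn1 : (0 : ℝ) < n - 1 := by
    have : (2 : ℝ) ≤ n := by exact_mod_cast hn
    linarith
  set φ : ℝ → ℝ≥0∞ := fun t => ENNReal.ofReal (f t) with hφ_def
  have hφ : Measurable φ := hf.ennreal_ofReal
  set G : ℝ → ℝ := fun t => n * unitBallVol n * Real.sinh (F t) ^ (n - 1) with hG_def
  set I : ℝ → ℝ := fun t => t * ((1 / t) * ∫ τ in Set.Ioo (0 : ℝ) t, f τ) / G t ^ 2 with hI_def
  change (∫⁻ s in Ioi (0 : ℝ), ENNReal.ofReal ((∫ t in Ioi s, I t) ^ p)) ^ (1 / p) < _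
  have hG : ∀ t, 0 < t → ((n : ℝ) - 1) * t < G t := fun t ht =>
    sub_one_mul_lt_of_inverse hn hF0 hF ht
  set A : ℝ → ℝ≥0∞ := fun t => ∫⁻ τ in Ioo 0 t, φ τ with hA_def
  have hI0 : ∀ t, 0 < t → 0 ≤ I t := fun t ht => by
    have : 0 ≤ ∫ τ in Ioo 0 t, f τ := integral_nonneg hf0
    positivity
  have hIA : ∀ t, 0 < t → ENNReal.ofReal (I t) ≤ ENNReal.ofReal (1 / G t ^ 2) * A t := by
    intro t ht
    have e : I t = 1 / G t ^ 2 * ∫ τ in Ioo 0 t, f τ := by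
      simp only [hI_def]
      rw [← mul_assoc, mul_one_div_cancel ht.ne']
      ring
    rw [e, ENNReal.ofReal_mul (by positivity)]
    gcongr
    exact ofReal_integral_le_lintegral_ofReal (ae_of_all _ hf0)
  have hhle : ∀ s, 0 < s →
      ENNReal.ofReal (∫ t in Ioi s, I t) ≤ ∫⁻ t in Ioi s, ENNReal.ofReal (I t) := by
    intro s hs
    refine ofReal_integral_le_lintegral_ofReal ?_
    filter_upwards [ae_restrict_mem measurableSet_Ioi] with t ht
    exact hI0 t (hs.trans ht)
  have hh0 : ∀ s, 0 < s → 0 ≤ ∫ t in Ioi s, I t := fun s hs =>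
    setIntegral_nonneg measurableSet_Ioi fun t ht => hI0 t (hs.trans ht)
  have hhp : ∀ s, 0 < s → ENNReal.ofReal ((∫ t in Ioi s, I t) ^ p) =
      ENNReal.ofReal (∫ t in Ioi s, I t) ^ p := fun s hs =>
    (ENNReal.ofReal_rpow_of_nonneg (hh0 s hs) hp0.le).symm
  have hB : 0 < p * q / ((n : ℝ) - 1) ^ 2 := by positivity
  rw [show (∫⁻ s in Ioi (0 : ℝ), ENNReal.ofReal ((∫ t in Ioi s, I t) ^ p)) =
    ∫⁻ s in Ioi (0 : ℝ), ENNReal.ofReal (∫ t in Ioi s, I t) ^ p from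
      setLIntegral_congr_fun measurableSet_Ioi hhp, one_div, ENNReal.rpow_inv_lt_iff hp0]
  by_cases hA : ∀ t, 0 < t → A t = 0
  · have hz : ∀ s ∈ Ioi (0 : ℝ), ENNReal.ofReal (∫ t in Ioi s, I t) ^ p = 0 := by
      intro s hs
      rw [ENNReal.rpow_eq_zero_iff_of_pos hp0, ← nonpos_iff_eq_zero]
      refine (hhle s hs).trans_eq ?_
      rw [setLIntegral_congr_fun (g := fun _ => 0) measurableSet_Ioi, lintegral_zero]
      intro t ht
      have ht0 : 0 < t := lt_trans (mem_Ioi.1 hs) ht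
      have := hIA t ht0
      rw [hA t ht0, mul_zero] at this
      exact nonpos_iff_eq_zero.1 this
    rw [setLIntegral_congr_fun (g := fun _ => 0) measurableSet_Ioi hz, lintegral_zero]
    exact ENNReal.rpow_pos (ENNReal.ofReal_pos.2 hB) ENNReal.ofReal_ne_top
  push Not at hA
  obtain ⟨T, hT, hAT⟩ := hA
  have hApos : ∀ t, T < t → A t ≠ 0 := fun t ht h0 => hAT <| nonpos_iff_eq_zero.1 <|
    (lintegral_mono_set (Ioo_subset_Ioo_right ht.le)).trans_eq h0
  have hφp : ∫⁻ t in Ioi (0 : ℝ), φ t ^ p ≤ 1 := by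
    refine le_trans (le_of_eq (lintegral_congr fun t => ?_)) hfp
    exact ENNReal.ofReal_rpow_of_nonneg (hf0 t) hp0.le
  have hM : ∫⁻ t in Ioi (0 : ℝ), hardyAverage φ t ^ p ≤ ENNReal.ofReal q ^ p :=
    (lintegral_hardyAverage_rpow_le hpq hφ).trans (mul_le_of_le_one_right' hφp)
  set c : ℝ≥0∞ := ENNReal.ofReal (1 / ((n : ℝ) - 1) ^ 2) with hc_def
  set K : ℝ → ℝ≥0∞ := fun s => c * hardyAdjoint (hardyAverage φ) s with hK_def
  have hKmeas : Measurable K := (measurable_hardyAdjoint _).const_mul c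
  have hK : ∫⁻ s in Ioi (0 : ℝ), K s ^ p ≤ ENNReal.ofReal (p * q / ((n : ℝ) - 1) ^ 2) ^ p := by
    have e : ENNReal.ofReal (p * q / ((n : ℝ) - 1) ^ 2) =
        c * (ENNReal.ofReal p * ENNReal.ofReal q) := by
      rw [hc_def, ← ENNReal.ofReal_mul hp0.le, ← ENNReal.ofReal_mul (by positivity)]
      congr 1
      ring
    simp only [hK_def, ENNReal.mul_rpow_of_nonneg _ _ hp0.le, e]
    rw [lintegral_const_mul _ ((measurable_hardyAdjoint _).pow_const p)]
    gcongr
    refine (lintegral_hardyAdjoint_rpow_le hpq (measurable_hardyAverage φ)).trans ?_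
    gcongr
  have hBtop : ENNReal.ofReal (p * q / ((n : ℝ) - 1) ^ 2) ^ p ≠ ∞ :=
    ENNReal.rpow_ne_top_of_nonneg hp0.le ENNReal.ofReal_ne_top
  have hKtop : ∀ᵐ s ∂volume.restrict (Ioi (0 : ℝ)), K s < ∞ := by
    filter_upwards [ae_lt_top (hKmeas.pow_const p) (hK.trans_lt hBtop.lt_top).ne] with s hs
    exact (ENNReal.rpow_lt_top_iff_of_pos hp0).1 hs
  have hAtop : ∀ᵐ t ∂volume.restrict (Ioi (0 : ℝ)), A t ≠ ∞ := by
    filter_upwards [ae_lt_top ((measurable_hardyAverage φ).pow_const p) (hM.trans_lt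
      (ENNReal.rpow_lt_top_of_nonneg hp0.le ENNReal.ofReal_ne_top)).ne,
      ae_restrict_mem measurableSet_Ioi] with t ht ht0 hcon
    refine ((ENNReal.rpow_lt_top_iff_of_pos hp0).1 ht).ne ?_
    have : (∫⁻ τ in Ioo 0 t, φ τ) = ∞ := hcon
    rw [hardyAverage, this, ENNReal.mul_top]
    exact (ENNReal.ofReal_pos.2 (one_div_pos.2 ht0)).ne'
  set P : ℝ → ℝ≥0∞ := fun t => c * (ENNReal.ofReal (1 / t) * hardyAverage φ t) with hP_def
  have hP' : Measurable fun t => ENNReal.ofReal (1 / t) * hardyAverage φ t :=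
    (measurable_const.div measurable_id).ennreal_ofReal.mul (measurable_hardyAverage φ)
  have hPmeas : Measurable P := hP'.const_mul c
  have hPA : ∀ t, 0 < t → P t = ENNReal.ofReal (1 / (((n : ℝ) - 1) * t) ^ 2) * A t := by
    intro t ht
    simp only [hP_def, hardyAverage, hc_def, hA_def]
    rw [← mul_assoc, ← mul_assoc, ← ENNReal.ofReal_mul (by positivity),
      ← ENNReal.ofReal_mul (by positivity)]
    congr 2
    field_simp
  have hGlt : ∀ t, 0 < t → 1 / G t ^ 2 < 1 / (((n : ℝ) - 1) * t) ^ 2 := by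
    intro t ht
    have := hG t ht
    have h0 : 0 < ((n : ℝ) - 1) * t := by positivity
    gcongr
  have hIP : ∀ t, 0 < t → ENNReal.ofReal (I t) ≤ P t := by
    intro t ht
    refine (hIA t ht).trans ?_
    rw [hPA t ht]
    gcongr ENNReal.ofReal ?_ * _
    exact (hGlt t ht).le
  have hIP' : ∀ᵐ t ∂volume.restrict (Ioi (0 : ℝ)), T < t → ENNReal.ofReal (I t) < P t := by
    filter_upwards [hAtop, ae_restrict_mem measurableSet_Ioi] with t htop ht0 hTt
    refine (hIA t ht0).trans_lt ?_
    rw [hPA t ht0]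
    refine ENNReal.mul_lt_mul_left (hApos t hTt) htop ?_
    have h0 : 0 < ((n : ℝ) - 1) * t := mul_pos hn1 ht0
    exact (ENNReal.ofReal_lt_ofReal_iff (by positivity)).2 (hGlt t ht0)
  have hKP : ∀ s, K s = ∫⁻ t in Ioi s, P t := fun s =>
    (lintegral_const_mul c hP').symm
  have hlt : ∀ᵐ s ∂volume.restrict (Ioi (0 : ℝ)),
      ENNReal.ofReal (∫ t in Ioi s, I t) ^ p < K s ^ p := by
    filter_upwards [hKtop, ae_restrict_mem measurableSet_Ioi] with s hsK hs
    refine ENNReal.rpow_lt_rpow ((hhle s hs).trans_lt ?_) hp0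
    have hle : ∀ᵐ t ∂volume.restrict (Ioi s), ENNReal.ofReal (I t) ≤ P t := by
      filter_upwards [ae_restrict_mem measurableSet_Ioi] with t ht
      exact hIP t (lt_trans hs ht)
    rw [hKP] at hsK ⊢
    refine lintegral_strict_mono_of_ae_le_of_ae_lt_on hPmeas.aemeasurable
      ((lintegral_mono_ae hle).trans_lt hsK).ne hle (s := Ioi T) ?_
      (ae_restrict_of_ae_restrict_of_subset (Ioi_subset_Ioi (le_of_lt hs)) hIP')
    rw [Measure.restrict_apply measurableSet_Ioi, Ioi_inter_Ioi, Real.volume_Ioi]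
    exact ENNReal.top_ne_zero
  refine lt_of_lt_of_le (lintegral_strict_mono ?_ (hKmeas.pow_const p).aemeasurable
    (((lintegral_mono_ae (hlt.mono fun _ h => h.le)).trans hK).trans_lt hBtop.lt_top).ne hlt) hK
  rw [Ne, Measure.restrict_eq_zero, Real.volume_Ioi]
  exact ENNReal.top_ne_zero
end
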